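/- Per-vertex residual sparsity (core claim in the proof of Lemma 1). Let n ≥ 3, let G be a finite simple graph on n vertices, and let t, j be integers with 1 ≤ t < n and t ≤ j ≤ n. If the greedy MIS process is run with a uniformly random ordering v_1, …, v_n, then with probability at least 1 − n^{−9}, either v_j ∉ U_t or |N_G(v_j) ∩ U_t| ≤ 10·ln(n)·n/t. -/

import Mathlib

open Finset
open scoped Classical

/-- The closed neighborhood of `v` as a `Finset`. -/
def closedNbhd {V : Type*} [Fintype V] [DecidableEq V] (G : SimpleGraph V)
    [DecidableRel G.Adj] (v : V) : Finset V :=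
  insert v (G.neighborFinset v)

/-- One pass of the sequential greedy MIS process over a list of vertices, carrying
the pair `(I, U)` of the current independent set and the current uncovered set. -/
def greedyStep {V : Type*} [Fintype V] [DecidableEq V] (G : SimpleGraph V)
    [DecidableRel G.Adj] : Finset V × Finset V → List V → Finset V × Finset V
  | p, [] => p
  | p, v :: rest =>
      greedyStep G (if v ∈ p.2 then (insert v p.1, p.2 \ closedNbhd G v) else p) rest

/-- `greedyU G σ t` is `U_t`: the set of uncovered vertices at the beginning of
iteration `t` (i.e. after the greedy process has handled `v_1, …, v_{t-1}`). -/
def greedyU {V : Type*} [Fintype V] [DecidableEq V] (G : SimpleGraph V)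
    [DecidableRel G.Adj] {n : ℕ} (σ : Fin n ≃ V) (t : ℕ) : Finset V :=
  (greedyStep G (∅, Finset.univ) ((List.ofFn ⇑σ).take (t - 1))).2

/-- Maximum degree of the subgraph of `G` induced by the vertex set `S`. -/
def maxDegOn {V : Type*} [Fintype V] [DecidableEq V] (G : SimpleGraph V)
    [DecidableRel G.Adj] (S : Finset V) : ℕ :=
  S.sup fun v => (G.neighborFinset v ∩ S).card

section GreedyProcess

variable {V : Type*} [Fintype V] [DecidableEq V] (G : SimpleGraph V) [DecidableRel G.Adj]

lemma greedyStep_append (p : Finset V × Finset V) (l l' : List V) :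
    greedyStep G p (l ++ l') = greedyStep G (greedyStep G p l) l' := by
  induction l generalizing p with
  | nil => rfl
  | cons v l ih => exact ih _

variable {n : ℕ}

lemma greedyU_succ (σ : Fin n ≃ V) (k : Fin n) :
    greedyU G σ (k + 1 + 1) =
      if σ k ∈ greedyU G σ (k + 1) then greedyU G σ (k + 1) \ closedNbhd G (σ k)
      else greedyU G σ (k + 1) := by
  have h : (List.ofFn ⇑σ).take (k + 1) = (List.ofFn ⇑σ).take k ++ [σ k] := by
    rw [List.take_succ_eq_append_getElem (by simp)]
    simp
  simp only [greedyU, Nat.add_sub_cancel, h, greedyStep_append]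
  simp only [greedyStep]
  split_ifs <;> rfl

/-- The uncovered set only depends on the part of the ordering already processed. -/
lemma greedyU_congr {σ τ : Fin n ≃ V} (k : ℕ) (hk : k ≤ n)
    (h : ∀ i : Fin n, (i : ℕ) < k → σ i = τ i) :
    greedyU G σ (k + 1) = greedyU G τ (k + 1) := by
  induction k with
  | zero => rfl
  | succ k ih =>
    have e := ih (by omega) fun i hi => h i (by omega)
    have hs := greedyU_succ G σ ⟨k, hk⟩
    have ht := greedyU_succ G τ ⟨k, hk⟩
    have hv := h ⟨k, hk⟩ (Nat.lt_succ_self k)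
    simp only at hs ht
    rw [hs, ht, e, hv]

lemma greedyU_succ_subset (σ : Fin n ≃ V) (k : Fin n) :
    greedyU G σ (k + 1 + 1) ⊆ greedyU G σ (k + 1) := by
  rw [greedyU_succ]
  split_ifs
  · exact Finset.sdiff_subset
  · exact Finset.Subset.refl _

lemma apply_notMem_greedyU (σ : Fin n ≃ V) (k : ℕ) (hk : k ≤ n) (i : Fin n)
    (hi : (i : ℕ) < k) : σ i ∉ greedyU G σ (k + 1) := by
  induction k with
  | zero => omega
  | succ k ih =>
    rcases Nat.lt_succ_iff_lt_or_eq.mp hi with hi' | rfl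
    · exact fun hm => ih (by omega) hi' (greedyU_succ_subset G σ ⟨k, hk⟩ hm)
    · rw [greedyU_succ]
      split_ifs with hm
      · simp [closedNbhd]
      · exact hm

/-- The orderings for which, after `k` steps, the vertex in position `q` is uncovered and has
more than `L` uncovered neighbors. -/
noncomputable def denseOrderings (q : Fin n) (L : ℝ) (k : ℕ) : Finset (Fin n ≃ V) :=
  Finset.univ.filter fun σ : Fin n ≃ V => σ q ∈ greedyU G σ (k + 1) ∧
    L < ((G.neighborFinset (σ q) ∩ greedyU G σ (k + 1)).card : ℝ)

variable {G}

lemma mem_denseOrderings {q : Fin n} {L : ℝ} {k : ℕ} {σ : Fin n ≃ V} :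
    σ ∈ denseOrderings G q L k ↔ σ q ∈ greedyU G σ (k + 1) ∧
      L < ((G.neighborFinset (σ q) ∩ greedyU G σ (k + 1)).card : ℝ) := by
  simp [denseOrderings]

lemma denseOrderings_succ_subset (q : Fin n) (L : ℝ) (k : Fin n) :
    denseOrderings G q L (k + 1) ⊆ denseOrderings G q L k := by
  intro σ hσ
  rw [mem_denseOrderings] at hσ ⊢
  have hs := greedyU_succ_subset G σ k
  refine ⟨hs hσ.1, hσ.2.trans_le ?_⟩
  exact_mod_cast Finset.card_le_card (Finset.inter_subset_inter_left hs)

lemma swap_trans_mem_denseOrderings {q k m : Fin n} {L : ℝ} (hkq : k < q) (hkm : k ≤ m)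
    (hmq : m ≠ q) {σ : Fin n ≃ V} (hσ : σ ∈ denseOrderings G q L k) :
    (Equiv.swap k m).trans σ ∈ denseOrderings G q L k := by
  have hU : greedyU G ((Equiv.swap k m).trans σ) (k + 1) = greedyU G σ (k + 1) := by
    refine greedyU_congr G k k.2.le fun i hi => ?_
    have h1 : i ≠ k := fun h => by simp [h] at hi
    have h2 : i ≠ m := fun h => absurd hi (by simpa [h] using hkm)
    simp [Equiv.swap_apply_of_ne_of_ne h1 h2]
  have hq : (Equiv.swap k m).trans σ q = σ q := by
    simp [Equiv.swap_apply_of_ne_of_ne hkq.ne' hmq.symm]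
  rw [mem_denseOrderings] at hσ ⊢
  rwa [hU, hq]

/-- Processing an uncovered neighbor of the vertex in position `q` covers that vertex. -/
lemma notMem_denseOrderings_succ {q k : Fin n} {L : ℝ} {σ : Fin n ≃ V}
    (h : σ k ∈ G.neighborFinset (σ q) ∩ greedyU G σ (k + 1)) :
    σ ∉ denseOrderings G q L (k + 1) := by
  rw [Finset.mem_inter, SimpleGraph.mem_neighborFinset] at h
  rw [mem_denseOrderings, greedyU_succ, if_pos h.2]
  simp [closedNbhd, h.1.symm]

/-- For an ordering dense after `k` steps, more than `L` of the available swaps of position `k`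
with a later position destroy density at the next step. -/
lemma card_swap_mem_denseOrderings_succ_le {q k : Fin n} {L : ℝ} (hkq : k < q) {σ : Fin n ≃ V}
    (hσ : σ ∈ denseOrderings G q L k) :
    ((((Finset.Ici k).erase q).filter fun m =>
        (Equiv.swap k m).trans σ ∈ denseOrderings G q L (k + 1)).card : ℝ) ≤
      ((Finset.Ici k).erase q).card - L := by
  set M := (Finset.Ici k).erase q
  set N := G.neighborFinset (σ q) ∩ greedyU G σ (k + 1)
  have hL : L < (N.card : ℝ) := (mem_denseOrderings.mp hσ).2
  have hsub : N.image σ.symm ⊆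
      M.filter fun m => ¬ (Equiv.swap k m).trans σ ∈ denseOrderings G q L (k + 1) := by
    intro m hm
    obtain ⟨w, hw, rfl⟩ := Finset.mem_image.mp hm
    have hw' := Finset.mem_inter.mp hw
    have hne : σ.symm w ≠ q := by
      intro h
      rw [Equiv.symm_apply_eq] at h
      subst h
      simp at hw'
    have hle : k ≤ σ.symm w := by
      by_contra! hlt
      exact apply_notMem_greedyU G σ k k.2.le _ hlt (by simpa using hw'.2)
    refine Finset.mem_filter.mpr ⟨by simp [M, hne, hle], ?_⟩
    have hU : greedyU G ((Equiv.swap k (σ.symm w)).trans σ) (k + 1) = greedyU G σ (k + 1) := by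
      refine greedyU_congr G k k.2.le fun i hi => ?_
      have h1 : i ≠ k := fun h => by simp [h] at hi
      have h2 : i ≠ σ.symm w := fun h => absurd hi (by simpa [h] using hle)
      simp [Equiv.swap_apply_of_ne_of_ne h1 h2]
    apply notMem_denseOrderings_succ
    have hq : Equiv.swap k (σ.symm w) q = q :=
      Equiv.swap_apply_of_ne_of_ne hkq.ne' hne.symm
    rw [hU, Equiv.trans_apply, Equiv.trans_apply, hq]
    simpa using hw'
  have h1 := Finset.card_le_card hsub
  rw [Finset.card_image_of_injective _ σ.symm.injective] at h1
  have h2 := Finset.card_filter_add_card_filter_not (s := M)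
    (fun m => (Equiv.swap k m).trans σ ∈ denseOrderings G q L (k + 1))
  have h1' : (N.card : ℝ) ≤ _ := Nat.cast_le.mpr h1
  have h2' := congrArg (Nat.cast : ℕ → ℝ) h2
  push_cast at h2'
  linarith

lemma card_denseOrderings_succ_le {q k : Fin n} {L : ℝ} (hL : 0 ≤ L) (hkq : k < q) :
    ((denseOrderings G q L (k + 1)).card : ℝ) ≤
      Real.exp (-(L / n)) * ((denseOrderings G q L k).card : ℝ) := by
  set M := (Finset.Ici k).erase q with hM
  set S := denseOrderings G q L k
  set T := denseOrderings G q L (k + 1)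
  have hcount : ∀ m ∈ M, (T.card : ℕ) ≤ (S.filter fun σ => (Equiv.swap k m).trans σ ∈ T).card := by
    intro m hm
    simp only [hM, Finset.mem_erase, Finset.mem_Ici] at hm
    have hinv : ∀ σ : Fin n ≃ V, (Equiv.swap k m).trans ((Equiv.swap k m).trans σ) = σ := by
      intro σ
      ext i
      simp
    refine Finset.card_le_card_of_injOn (fun σ => (Equiv.swap k m).trans σ) ?_ ?_
    · intro σ hσ
      simp only [Finset.coe_filter, Set.mem_ofPred_eq, hinv]
      exact ⟨swap_trans_mem_denseOrderings hkq hm.2 hm.1 (denseOrderings_succ_subset q L k hσ), hσ⟩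
    · intro σ _ τ _ h
      rw [← hinv σ, ← hinv τ]
      exact congrArg _ h
  have hdouble : ((M.card : ℝ) * T.card) ≤ (M.card - L) * S.card := by
    calc ((M.card : ℝ) * T.card) = ∑ _m ∈ M, (T.card : ℝ) := by simp
      _ ≤ ∑ m ∈ M, ((S.filter fun σ => (Equiv.swap k m).trans σ ∈ T).card : ℝ) :=
        Finset.sum_le_sum fun m hm => by exact_mod_cast hcount m hm
      _ = ∑ σ ∈ S, ((M.filter fun m => (Equiv.swap k m).trans σ ∈ T).card : ℝ) := by
        exact_mod_cast Finset.sum_card_bipartiteAbove_eq_sum_card_bipartiteBelow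
          (s := M) (t := S) fun m σ => (Equiv.swap k m).trans σ ∈ T
      _ ≤ ∑ _σ ∈ S, ((M.card : ℝ) - L) :=
        Finset.sum_le_sum fun σ hσ => card_swap_mem_denseOrderings_succ_le hkq hσ
      _ = (M.card - L) * S.card := by rw [Finset.sum_const, nsmul_eq_mul, mul_comm]
  have hMpos : (0 : ℝ) < M.card := by
    exact_mod_cast Finset.card_pos.mpr ⟨k, by simp [hM, hkq.ne]⟩
  have hMn : (M.card : ℝ) ≤ n := by
    exact_mod_cast (Finset.card_le_univ M).trans_eq (Fintype.card_fin n)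
  have hfrac : L / n ≤ L / M.card := div_le_div_of_nonneg_left hL hMpos hMn
  calc (T.card : ℝ) ≤ (1 - L / M.card) * S.card := by
        refine le_of_mul_le_mul_left (hdouble.trans_eq ?_) hMpos
        field_simp
    _ ≤ Real.exp (-(L / n)) * S.card := by
        refine mul_le_mul_of_nonneg_right ?_ (Nat.cast_nonneg _)
        linarith [Real.add_one_le_exp (-(L / n))]

lemma card_denseOrderings_le {q : Fin n} {L : ℝ} (hL : 0 ≤ L) (k : ℕ) (hkq : k ≤ q) :
    ((denseOrderings G q L k).card : ℝ) ≤
      Real.exp (-(L / n)) ^ k * (Fintype.card (Fin n ≃ V) : ℝ) := by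
  induction k with
  | zero => simpa using Finset.card_le_univ _
  | succ k ih =>
    have h := card_denseOrderings_succ_le (G := G) (k := ⟨k, by omega⟩) hL (Fin.lt_def.mpr hkq)
    refine h.trans ?_
    rw [pow_succ', mul_assoc]
    exact mul_le_mul_of_nonneg_left (ih (by omega)) (Real.exp_pos _).le

end GreedyProcess

/-- **Per-vertex residual sparsity.** For a fixed position `j` with `t ≤ j ≤ n`,
with probability at least `1 - n ^ (-9)` over a uniformly random ordering, either
`v_j` is covered by the beginning of iteration `t`, or `v_j` has at most
`10 · ln n · n / t` uncovered neighbors at that point. -/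
theorem per_vertex_residual_sparsity
    {V : Type*} [Fintype V] [DecidableEq V] {n : ℕ} (hn : 3 ≤ n)
    (hcard : Fintype.card V = n)
    (G : SimpleGraph V) [DecidableRel G.Adj]
    (t j : ℕ) (ht1 : 1 ≤ t) (htn : t < n) (htj : t ≤ j) (hjn : j ≤ n) :
    (1 - (n : ℝ) ^ (-9 : ℤ)) * (Fintype.card (Fin n ≃ V) : ℝ) ≤
      ((Finset.univ.filter (fun σ : Fin n ≃ V =>
        σ ⟨j - 1, by omega⟩ ∉ greedyU G σ t ∨
          ((G.neighborFinset (σ ⟨j - 1, by omega⟩) ∩ greedyU G σ t).card : ℝ) ≤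
            10 * Real.log n * n / t)).card : ℝ) := by
  have hn0 : (0 : ℝ) < n := by positivity
  have ht0 : (0 : ℝ) < t := by positivity
  have hlog : 1 ≤ Real.log n := by
    rw [Real.le_log_iff_exp_le hn0]
    have : (3 : ℝ) ≤ n := by exact_mod_cast hn
    linarith [Real.exp_one_lt_d9]
  set q : Fin n := ⟨j - 1, by omega⟩ with hq
  set L : ℝ := 10 * Real.log n * n / t with hLdef
  have hL : 0 ≤ L := by positivity
  have hdense : ((denseOrderings G q L (t - 1)).card : ℝ) ≤
      (n : ℝ) ^ (-9 : ℤ) * (Fintype.card (Fin n ≃ V) : ℝ) := by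
    rcases lt_or_ge t 10 with ht | ht
    · have hnL : (n : ℝ) ≤ L := by
        rw [hLdef, le_div_iff₀ ht0, mul_comm]
        have : (t : ℝ) ≤ 10 := by exact_mod_cast ht.le
        exact mul_le_mul_of_nonneg_right (by linarith) hn0.le
      have hempty : denseOrderings G q L (t - 1) = ∅ := by
        refine Finset.eq_empty_of_forall_notMem fun σ hσ => ?_
        have h1 := (mem_denseOrderings.mp hσ).2
        have h2 := Finset.card_le_univ (G.neighborFinset (σ q) ∩ greedyU G σ (t - 1 + 1))
        rw [hcard] at h2
        have h3 := Nat.cast_le (α := ℝ).mpr h2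
        linarith
      rw [hempty, Finset.card_empty, Nat.cast_zero]
      positivity
    · refine (card_denseOrderings_le hL (t - 1) (by simp [hq]; omega)).trans ?_
      refine mul_le_mul_of_nonneg_right ?_ (Nat.cast_nonneg _)
      have hz : (n : ℝ) ^ (-9 : ℤ) = Real.exp (-9 * Real.log n) := by
        rw [← Real.rpow_intCast, Real.rpow_def_of_pos hn0, mul_comm]
        norm_num
      rw [hz, ← Real.exp_nat_mul, Nat.cast_sub ht1]
      refine Real.exp_le_exp.mpr ?_
      have hfrac : (0.9 : ℝ) ≤ (t - 1) / t := by
        rw [le_div_iff₀ ht0]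
        have : (10 : ℝ) ≤ t := by exact_mod_cast ht
        linarith
      have heq : ((t : ℝ) - (1 : ℕ)) * -(L / n) = -(10 * Real.log n * ((t - 1) / t)) := by
        rw [hLdef]
        push_cast
        field_simp
      rw [heq]
      nlinarith
  have hsplit := Finset.card_filter_add_card_filter_not (s := (Finset.univ : Finset (Fin n ≃ V)))
    (fun σ => σ q ∉ greedyU G σ t ∨
      ((G.neighborFinset (σ q) ∩ greedyU G σ t).card : ℝ) ≤ L)
  have hcompl : (Finset.univ.filter fun σ : Fin n ≃ V => ¬ (σ q ∉ greedyU G σ t ∨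
      ((G.neighborFinset (σ q) ∩ greedyU G σ t).card : ℝ) ≤ L)) =
        denseOrderings G q L (t - 1) := by
    ext σ
    simp [mem_denseOrderings, Nat.sub_add_cancel ht1]
  rw [hcompl, Finset.card_univ] at hsplit
  have hsplit' := congrArg (Nat.cast : ℕ → ℝ) hsplit
  push_cast at hsplit'
  linarith
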